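/- Let 𝒯 = (T, σ, 1) be a singly seeded mismatch-free RTAM system at temperature 1 in which a finite connected shape S ⊆ ℤ² strictly self-assembles, and let α be a terminal assembly of 𝒯. Then the binding graph of α is a tree. -/

import Mathlib

/-! # Reflexive Tile Assembly Model (RTAM) -/

/-- A glue: `none` is the null glue; `some (l, s)` has label `l : ℤ` and strength `s : ℕ`.
The complement of the label `l` is `-l`. -/
abbrev Glue : Type := Option (ℤ × ℕ)

/-- Strength with which two abutting glues bind: `s` if the labels are complementary and
the strengths are both equal to `s`, and `0` otherwise. -/
def glueBind : Glue → Glue → ℕ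
  | some (l₁, s₁), some (l₂, s₂) => if l₂ = -l₁ ∧ s₂ = s₁ then s₁ else 0
  | _, _ => 0

/-- Two abutting glues match (for mismatch-freeness): both null, or complementary labels
with equal strengths. -/
def GlueMatch (g h : Glue) : Prop :=
  (g = none ∧ h = none) ∨ ∃ l s, g = some (l, s) ∧ h = some (-l, s)

/-- A tile type: glues on the north, east, south and west sides (in that order). -/
abbrev TileType : Type := Glue × Glue × Glue × Glue

def TileType.north (t : TileType) : Glue := t.1
def TileType.east (t : TileType) : Glue := t.2.1
def TileType.south (t : TileType) : Glue := t.2.2.1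
def TileType.west (t : TileType) : Glue := t.2.2.2

/-- A reflection `(h, v)`: `h` indicates a flip across the vertical axis (swapping east and
west and negating `x`), `v` a flip across the horizontal axis (swapping north and south and
negating `y`).  `D = (false, false)`, `H = (true, false)`, `V = (false, true)`,
`B = (true, true)`. -/
abbrev Reflection : Type := Bool × Bool

/-- Composition of reflections (the Klein four-group). -/
def Reflection.comp (r s : Reflection) : Reflection := (xor r.1 s.1, xor r.2 s.2)

/-- The action of a reflection on a point of `ℤ²`. -/
def Reflection.onPoint (r : Reflection) (p : ℤ × ℤ) : ℤ × ℤ :=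
  (if r.1 then -p.1 else p.1, if r.2 then -p.2 else p.2)

/-- The tile type obtained by reflecting `t` according to `r` (glues are unchanged, sides
are permuted). -/
def TileType.reflect (t : TileType) (r : Reflection) : TileType :=
  (if r.2 then TileType.south t else TileType.north t,
   if r.1 then TileType.west t else TileType.east t,
   if r.2 then TileType.north t else TileType.south t,
   if r.1 then TileType.east t else TileType.west t)

/-- A placed tile: a tile type together with its reflection. -/
abbrev Placement : Type := TileType × Reflection

/-- An assembly: a partial function from `ℤ²` to placed tiles. -/
abbrev Assembly : Type := ℤ × ℤ → Option Placement

/-- The domain of an assembly. -/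
def adom (α : Assembly) : Set (ℤ × ℤ) := {p | α p ≠ none}

/-- The glue presented by the placed tile `pl` at position `p` on the side facing
position `q` (the null glue if `q` is not adjacent to `p`). -/
def facingGlue (pl : Placement) (p q : ℤ × ℤ) : Glue :=
  if q = (p.1 + 1, p.2) then TileType.east (TileType.reflect pl.1 pl.2)
  else if q = (p.1 - 1, p.2) then TileType.west (TileType.reflect pl.1 pl.2)
  else if q = (p.1, p.2 + 1) then TileType.north (TileType.reflect pl.1 pl.2)
  else if q = (p.1, p.2 - 1) then TileType.south (TileType.reflect pl.1 pl.2)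
  else none

/-- The strength of the bond between the tiles of `α` at positions `p` and `q`. -/
def bondStrength (α : Assembly) (p q : ℤ × ℤ) : ℕ :=
  match α p, α q with
  | some a, some b => glueBind (facingGlue a p q) (facingGlue b q p)
  | _, _ => 0

/-- Adjacency in the binding graph of `α`. -/
def BondAdj (α : Assembly) (p q : ℤ × ℤ) : Prop := 0 < bondStrength α p q

/-- `α` is `τ`-stable: every cut of its binding graph has total strength at least `τ`
(i.e. some finite set of crossing edges already has total strength at least `τ`). -/
def Stable (α : Assembly) (τ : ℕ) : Prop :=
  ∀ A : Set (ℤ × ℤ), A ⊆ adom α → A.Nonempty → (adom α \ A).Nonempty →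
    ∃ E : Finset ((ℤ × ℤ) × (ℤ × ℤ)),
      (∀ e ∈ E, e.1 ∈ A ∧ e.2 ∈ adom α \ A) ∧
      τ ≤ ∑ e ∈ E, bondStrength α e.1 e.2

/-- An RTAM tile assembly system: a finite tile set, a finite stable seed assembly, and a
temperature. -/
structure RTAS where
  tiles : Finset TileType
  seed : Assembly
  temp : ℕ
  seed_nonempty : (adom seed).Nonempty
  seed_finite : (adom seed).Finite
  seed_tiles : ∀ p pl, seed p = some pl → pl.1 ∈ tiles
  seed_stable : Stable seed temp

/-- `β` is obtained from `α` by `τ`-stably attaching a single tile (in any reflection) at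
an empty position. -/
def Attaches (S : RTAS) (α β : Assembly) : Prop :=
  ∃ (p : ℤ × ℤ) (t : TileType) (r : Reflection),
    α p = none ∧ t ∈ S.tiles ∧ β = Function.update α p (some (t, r)) ∧ Stable β S.temp

/-- Producible assemblies: those reachable from the seed in finitely many attachment steps
or in the limit. -/
def Producible (S : RTAS) (α : Assembly) : Prop :=
  ∃ f : ℕ → Assembly, f 0 = S.seed ∧
    (∀ n, f (n + 1) = f n ∨ Attaches S (f n) (f (n + 1))) ∧
    (∀ p pl, α p = some pl ↔ ∃ n, f n p = some pl)

/-- Terminal assemblies: producible assemblies admitting no further attachment. -/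
def Terminal (S : RTAS) (α : Assembly) : Prop :=
  Producible S α ∧ ∀ β, ¬ Attaches S α β

/-- Apply the reflection `r` and then the translation `v` to the assembly `α`. -/
def transform (α : Assembly) (r : Reflection) (v : ℤ × ℤ) : Assembly :=
  fun p => (α (Reflection.onPoint r (p - v))).map fun pl => (pl.1, Reflection.comp r pl.2)

/-- The configuration of an assembly: forget the reflections of the placed tiles. -/
def config (α : Assembly) : ℤ × ℤ → Option TileType := fun p => (α p).map Prod.fst

/-- A system is directed if any two producible assemblies have the same configuration up
to a reflection and a translation. -/
def RTASDirected (S : RTAS) : Prop :=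
  ∀ α β, Producible S α → Producible S β →
    ∃ (r : Reflection) (v : ℤ × ℤ), config (transform β r v) = config α

/-- A system is singly seeded if its seed consists of a single tile. -/
def SinglySeeded (S : RTAS) : Prop := ∃ p, adom S.seed = {p}

/-- `X` weakly self-assembles in `S`. -/
def WeaklySelfAssembles (S : RTAS) (X : Set (ℤ × ℤ)) : Prop :=
  ∃ B ⊆ S.tiles, ∀ α, Terminal S α →
    ∃ (r : Reflection) (v : ℤ × ℤ),
      {p | ∃ pl, transform α r v p = some pl ∧ pl.1 ∈ B} = X

/-- `X` strictly self-assembles in `S`. -/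
def StrictlySelfAssembles (S : RTAS) (X : Set (ℤ × ℤ)) : Prop :=
  ∀ α, Terminal S α →
    ∃ (r : Reflection) (v : ℤ × ℤ), adom (transform α r v) = X

/-- A semi-doubly periodic subset of `ℤ²`. -/
def SemiDoublyPeriodic (X : Set (ℤ × ℤ)) : Prop :=
  ∃ b u v : ℤ × ℤ, X = {p | ∃ n m : ℕ, p = b + (n : ℤ) • u + (m : ℤ) • v}

/-- A finite union of semi-doubly periodic sets. -/
def FiniteUnionSDP (X : Set (ℤ × ℤ)) : Prop :=
  ∃ (k : ℕ) (f : Fin k → Set (ℤ × ℤ)),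
    (∀ i, SemiDoublyPeriodic (f i)) ∧ X = ⋃ i, f i

/-- The box of radius `c` centered at `v`. -/
def box (c : ℕ) (v : ℤ × ℤ) : Set (ℤ × ℤ) :=
  {p | |p.1 - v.1| ≤ (c : ℤ) ∧ |p.2 - v.2| ≤ (c : ℤ)}

/-- The `n × m` rectangle `{0, …, n−1} × {0, …, m−1} ⊆ ℤ²`. -/
def rectShape (n m : ℕ) : Set (ℤ × ℤ) :=
  {p | 0 ≤ p.1 ∧ p.1 < (n : ℤ) ∧ 0 ≤ p.2 ∧ p.2 < (m : ℤ)}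

/-- The `n × n` square `{0, …, n−1}² ⊆ ℤ²`. -/
def squareShape (n : ℕ) : Set (ℤ × ℤ) := rectShape n n

/-- Grid adjacency on `ℤ²`. -/
def GridAdj (p q : ℤ × ℤ) : Prop := (p.1 - q.1).natAbs + (p.2 - q.2).natAbs = 1

/-- `X` is connected in the grid graph. -/
def GridConnectedOn (X : Set (ℤ × ℤ)) : Prop :=
  ∀ p ∈ X, ∀ q ∈ X, Relation.ReflTransGen (fun a b => GridAdj a b ∧ a ∈ X ∧ b ∈ X) p q

/-- A shape: a finite nonempty connected subset of `ℤ²`. -/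
def IsShape (X : Set (ℤ × ℤ)) : Prop := X.Finite ∧ X.Nonempty ∧ GridConnectedOn X

/-- A system is mismatch-free: in every producible assembly, abutting sides of adjacent
tiles are either both null or carry complementary glues of equal strength. -/
def MismatchFree (S : RTAS) : Prop :=
  ∀ α, Producible S α → ∀ p q a b, GridAdj p q → α p = some a → α q = some b →
    GlueMatch (facingGlue a p q) (facingGlue b q p)

/-- `X` is odd-symmetric with respect to some horizontal or vertical line through lattice
points. -/
def OddSymmetric (X : Set (ℤ × ℤ)) : Prop :=
  (∃ l : ℤ, ∀ a b : ℤ, ((a, l - b) ∈ X ↔ (a, l + b) ∈ X)) ∨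
  (∃ l : ℤ, ∀ a b : ℤ, ((l - a, b) ∈ X ↔ (l + a, b) ∈ X))

/-- The binding graph of `α` is a tree: connected on `adom α` and every edge is a bridge. -/
def BindingGraphIsTree (α : Assembly) : Prop :=
  (∀ p ∈ adom α, ∀ q ∈ adom α, Relation.ReflTransGen (BondAdj α) p q) ∧
  (∀ p q, BondAdj α p q →
    ¬ Relation.ReflTransGen
      (fun a b => BondAdj α a b ∧ ¬((a = p ∧ b = q) ∨ (a = q ∧ b = p))) p q)

/-- A spanning tree of the grid graph of a shape `X`. -/
structure TreeOf (X : Set (ℤ × ℤ)) where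
  adj : ℤ × ℤ → ℤ × ℤ → Prop
  symm : ∀ p q, adj p q → adj q p
  valid : ∀ p q, adj p q → p ∈ X ∧ q ∈ X ∧ GridAdj p q
  connected : ∀ p ∈ X, ∀ q ∈ X, Relation.ReflTransGen adj p q
  acyclic : ∀ p q, adj p q →
    ¬ Relation.ReflTransGen
      (fun a b => adj a b ∧ ¬((a = p ∧ b = q) ∨ (a = q ∧ b = p))) p q

/-- The vertex set of a horizontal axis at height `l` from `x₁` to `x₂`. -/
def hAxisSet (l x₁ x₂ : ℤ) : Set (ℤ × ℤ) := {p | p.2 = l ∧ x₁ ≤ p.1 ∧ p.1 ≤ x₂}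

/-- The vertex set of a vertical axis at abscissa `l` from `y₁` to `y₂`. -/
def vAxisSet (l y₁ y₂ : ℤ) : Set (ℤ × ℤ) := {p | p.1 = l ∧ y₁ ≤ p.2 ∧ p.2 ≤ y₂}

/-- A (maximal) horizontal axis of the tree `t`: consecutive vertices on the line `y = l`
joined by tree edges, not extendable on either end. -/
def IsHAxis {X : Set (ℤ × ℤ)} (t : TreeOf X) (l x₁ x₂ : ℤ) : Prop :=
  x₁ ≤ x₂ ∧ (∀ x, x₁ ≤ x → x ≤ x₂ → ((x, l) : ℤ × ℤ) ∈ X) ∧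
  (∀ x, x₁ ≤ x → x < x₂ → t.adj (x, l) (x + 1, l)) ∧
  ¬ t.adj (x₁ - 1, l) (x₁, l) ∧ ¬ t.adj (x₂, l) (x₂ + 1, l)

/-- A (maximal) vertical axis of the tree `t`. -/
def IsVAxis {X : Set (ℤ × ℤ)} (t : TreeOf X) (l y₁ y₂ : ℤ) : Prop :=
  y₁ ≤ y₂ ∧ (∀ y, y₁ ≤ y → y ≤ y₂ → ((l, y) : ℤ × ℤ) ∈ X) ∧
  (∀ y, y₁ ≤ y → y < y₂ → t.adj (l, y) (l, y + 1)) ∧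
  ¬ t.adj (l, y₁ - 1) (l, y₁) ∧ ¬ t.adj (l, y₂) (l, y₂ + 1)

/-- The union of the axial branches of `t` beginning from `v` relative to the axis `a`
(together with `v` itself): everything reachable from `v` through a neighbor not on `a`
without revisiting `v`. -/
def branch {X : Set (ℤ × ℤ)} (t : TreeOf X) (a : Set (ℤ × ℤ)) (v : ℤ × ℤ) :
    Set (ℤ × ℤ) :=
  {v} ∪ {p | ∃ w, t.adj v w ∧ w ∉ a ∧
    Relation.ReflTransGen (fun x y => t.adj x y ∧ x ≠ v ∧ y ≠ v) w p}

/-- The axial branches of `t` beginning from `v` are symmetric across the reflection `ρ`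
(of `ℤ²` across the line of the axis `a`). -/
def BranchSymmetric {X : Set (ℤ × ℤ)} (t : TreeOf X) (a : Set (ℤ × ℤ))
    (ρ : ℤ × ℤ → ℤ × ℤ) (v : ℤ × ℤ) : Prop :=
  (∀ p ∈ branch t a v, ρ p ∈ branch t a v) ∧
  (∀ p q, p ∈ branch t a v → q ∈ branch t a v → t.adj p q → t.adj (ρ p) (ρ q))

/-- `t` is off-by-one symmetric across the horizontal axis determined by `(l, x₁, x₂)`:
the branches from every vertex of the axis, except at most one, are symmetric across it. -/
def OffByOneH {X : Set (ℤ × ℤ)} (t : TreeOf X) (l x₁ x₂ : ℤ) : Prop :=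
  ∃ v₀ : ℤ × ℤ, ∀ x, x₁ ≤ x → x ≤ x₂ → ((x, l) : ℤ × ℤ) ≠ v₀ →
    BranchSymmetric t (hAxisSet l x₁ x₂) (fun p => (p.1, 2 * l - p.2)) (x, l)

/-- `t` is off-by-one symmetric across the vertical axis determined by `(l, y₁, y₂)`. -/
def OffByOneV {X : Set (ℤ × ℤ)} (t : TreeOf X) (l y₁ y₂ : ℤ) : Prop :=
  ∃ v₀ : ℤ × ℤ, ∀ y, y₁ ≤ y → y ≤ y₂ → ((l, y) : ℤ × ℤ) ≠ v₀ →
    BranchSymmetric t (vAxisSet l y₁ y₂) (fun p => (2 * l - p.1, p.2)) (l, y)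

/-- A tree is ε-symmetric if it is off-by-one symmetric across each of its axes. -/
def TreeOf.EpsSymmetric {X : Set (ℤ × ℤ)} (t : TreeOf X) : Prop :=
  (∀ l x₁ x₂, IsHAxis t l x₁ x₂ → OffByOneH t l x₁ x₂) ∧
  (∀ l y₁ y₂, IsVAxis t l y₁ y₂ → OffByOneV t l y₁ y₂)

/-- A shape is ε-symmetric if some spanning tree of its grid graph is ε-symmetric. -/
def EpsSymmetricShape (X : Set (ℤ × ℤ)) : Prop :=
  ∃ t : TreeOf X, TreeOf.EpsSymmetric t

/-- The `c`-scaling of a shape: replace each point by a `c × c` block. -/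
def scaleShape (X : Set (ℤ × ℤ)) (c : ℕ) : Set (ℤ × ℤ) :=
  {p | (Int.fdiv p.1 (c : ℤ), Int.fdiv p.2 (c : ℤ)) ∈ X}

/-- The assembly encoded by a finite list of placed tiles. -/
def listAssembly (L : List ((ℤ × ℤ) × Placement)) : Assembly :=
  fun p => (L.find? fun e => decide (e.1 = p)).map Prod.snd

open Relation

/-- `B` agrees with `A` on the domain of `A`. -/
def Assembly.Extends (A B : Assembly) : Prop := ∀ p pl, A p = some pl → B p = some pl

/-- `γ` is the limit of an assembly sequence of `S` that starts at `A`. -/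
def Yields (S : RTAS) (A γ : Assembly) : Prop :=
  ∃ f : ℕ → Assembly, f 0 = A ∧
    (∀ n, f (n + 1) = f n ∨ Attaches S (f n) (f (n + 1))) ∧
    (∀ p pl, γ p = some pl ↔ ∃ n, f n p = some pl)

/-- The binding graph of `A` is connected. -/
def BondConnected (A : Assembly) : Prop :=
  ∀ p ∈ adom A, ∀ q ∈ adom A, ReflTransGen (BondAdj A) p q

/-- Bond adjacency with the edge between `p` and `q` removed. -/
def BondAdjAvoiding (A : Assembly) (p q a b : ℤ × ℤ) : Prop :=
  BondAdj A a b ∧ ¬((a = p ∧ b = q) ∨ (a = q ∧ b = p))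

/-- An infinite walk in the binding graph of `A` that never traverses an edge twice in
succession. -/
def NonBacktracking (A : Assembly) (w : ℕ → ℤ × ℤ) : Prop :=
  ∀ n, BondAdj A (w n) (w (n + 1)) ∧ w (n + 2) ≠ w n

theorem mem_adom_iff {A : Assembly} {p : ℤ × ℤ} : p ∈ adom A ↔ ∃ pl, A p = some pl :=
  Option.ne_none_iff_exists'

theorem bondAdj_iff {A : Assembly} {p q : ℤ × ℤ} :
    BondAdj A p q ↔ ∃ a b, A p = some a ∧ A q = some b ∧
      0 < glueBind (facingGlue a p q) (facingGlue b q p) := by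
  unfold BondAdj bondStrength
  cases A p <;> cases A q <;> simp

theorem glueBind_comm (g h : Glue) : glueBind g h = glueBind h g := by
  rcases g with _ | ⟨l, s⟩ <;> rcases h with _ | ⟨m, t⟩ <;> simp only [glueBind]
  by_cases h1 : m = -l ∧ t = s
  · obtain ⟨rfl, rfl⟩ := h1
    simp
  · have h2 : ¬(l = -m ∧ s = t) := by
      rintro ⟨rfl, rfl⟩
      simp at h1
    simp [h1, h2]

theorem BondAdj.symm {A : Assembly} {p q : ℤ × ℤ} (h : BondAdj A p q) : BondAdj A q p := by
  obtain ⟨a, b, ha, hb, hab⟩ := bondAdj_iff.1 h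
  exact bondAdj_iff.2 ⟨b, a, hb, ha, by rwa [glueBind_comm]⟩

theorem BondAdj.mem_left {A : Assembly} {p q : ℤ × ℤ} (h : BondAdj A p q) : p ∈ adom A := by
  obtain ⟨a, _, ha, _⟩ := bondAdj_iff.1 h
  exact mem_adom_iff.2 ⟨a, ha⟩

theorem BondAdj.mem_right {A : Assembly} {p q : ℤ × ℤ} (h : BondAdj A p q) : q ∈ adom A :=
  h.symm.mem_left

theorem BondAdj.gridAdj {A : Assembly} {p q : ℤ × ℤ} (h : BondAdj A p q) : GridAdj p q := by
  obtain ⟨a, b, -, -, hab⟩ := bondAdj_iff.1 h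
  by_contra hpq
  have hnone : facingGlue a p q = none := by
    unfold facingGlue
    rw [if_neg, if_neg, if_neg, if_neg] <;>
      · rintro rfl
        simp [GridAdj] at hpq
  simp [hnone, glueBind] at hab

theorem BondAdj.ne {A : Assembly} {p q : ℤ × ℤ} (h : BondAdj A p q) : p ≠ q := by
  rintro rfl
  simpa [GridAdj] using h.gridAdj

theorem BondAdj.mono {A B : Assembly} (hAB : A.Extends B) {p q : ℤ × ℤ} (h : BondAdj A p q) :
    BondAdj B p q := by
  obtain ⟨a, b, ha, hb, hab⟩ := bondAdj_iff.1 h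
  exact bondAdj_iff.2 ⟨a, b, hAB _ _ ha, hAB _ _ hb, hab⟩

theorem stable_one_iff {A : Assembly} : Stable A 1 ↔ BondConnected A := by
  constructor
  · intro h p hp q hq
    by_contra hpq
    obtain ⟨E, hE, hsum⟩ := h {x | x ∈ adom A ∧ ReflTransGen (BondAdj A) p x}
      (fun x hx => hx.1) ⟨p, hp, .refl⟩ ⟨q, hq, fun hx => hpq hx.2⟩
    obtain ⟨e, heE, he⟩ := Finset.exists_ne_zero_of_sum_ne_zero (Nat.one_le_iff_ne_zero.1 hsum)
    obtain ⟨h1, h2, h3⟩ := hE e heE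
    exact h3 ⟨h2, h1.2.tail (Nat.pos_of_ne_zero he)⟩
  · rintro h B hB ⟨b, hb⟩ ⟨c, hc, hcB⟩
    have key : ∀ x, ReflTransGen (BondAdj A) b x → x ∈ B ∨
        ∃ u ∈ B, ∃ v ∈ adom A \ B, BondAdj A u v := by
      intro x hx
      induction hx with
      | refl => exact .inl hb
      | @tail y z _ hyz ih =>
        rcases ih with ih | ih
        · by_cases hz : z ∈ B
          · exact .inl hz
          · exact .inr ⟨y, ih, z, ⟨hyz.mem_right, hz⟩, hyz⟩
        · exact .inr ih
    obtain ⟨u, hu, v, hv, huv⟩ := (key c (h b (hB hb) c hc)).resolve_left hcB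
    exact ⟨{(u, v)}, by simpa using ⟨hu, hv⟩, by simpa using Nat.succ_le_of_lt huv⟩

theorem extends_update {A : Assembly} {p : ℤ × ℤ} (hp : A p = none) (x : Option Placement) :
    A.Extends (Function.update A p x) := by
  intro q pl hq
  rw [Function.update_of_ne (by rintro rfl; simp [hp] at hq)]
  exact hq

theorem Attaches.extends {S : RTAS} {A B : Assembly} (h : Attaches S A B) : A.Extends B := by
  obtain ⟨p, t, r, hp, -, rfl, -⟩ := h
  exact extends_update hp _

/-- At temperature 1, a tile attaches stably as soon as it binds to one tile of the assembly. -/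
theorem bondConnected_update {A : Assembly} (hA : BondConnected A) {p q : ℤ × ℤ}
    {x : Option Placement} (hp : A p = none) (hq : q ∈ adom A)
    (hpq : BondAdj (Function.update A p x) p q) : BondConnected (Function.update A p x) := by
  have hext := extends_update hp x
  have hto : ∀ a ∈ adom (Function.update A p x),
      ReflTransGen (BondAdj (Function.update A p x)) a q ∧
      ReflTransGen (BondAdj (Function.update A p x)) q a := by
    intro a ha
    by_cases hap : a = p
    · subst hap
      exact ⟨.single hpq, .single hpq.symm⟩
    · have ha' : a ∈ adom A := by simpa [adom, Function.update_of_ne hap] using ha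
      exact ⟨(hA a ha' q hq).lift id fun _ _ h => h.mono hext,
        (hA q hq a ha').lift id fun _ _ h => h.mono hext⟩
  exact fun a ha b hb => (hto a ha).1.trans (hto b hb).2

section Sequences

variable {S : RTAS} {f : ℕ → Assembly}

theorem extends_of_le (hf : ∀ n, f (n + 1) = f n ∨ Attaches S (f n) (f (n + 1))) {m n : ℕ}
    (hmn : m ≤ n) : (f m).Extends (f n) := by
  induction n, hmn using Nat.le_induction with
  | base => exact fun _ _ h => h
  | succ n _ ih =>
    intro p pl h
    rcases hf n with hn | hn
    · rw [hn]
      exact ih p pl h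
    · exact hn.extends p pl (ih p pl h)

theorem bondConnected_of_steps (hτ : S.temp = 1) (h0 : BondConnected (f 0))
    (hf : ∀ n, f (n + 1) = f n ∨ Attaches S (f n) (f (n + 1))) (n : ℕ) :
    BondConnected (f n) := by
  induction n with
  | zero => exact h0
  | succ n ih =>
    rcases hf n with hn | ⟨p, t, r, -, -, -, hst⟩
    · rwa [hn]
    · rw [hτ] at hst
      exact stable_one_iff.1 hst

end Sequences

theorem Yields.extends {S : RTAS} {A γ : Assembly} (h : Yields S A γ) : A.Extends γ := by
  obtain ⟨f, rfl, -, hγ⟩ := h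
  exact fun p pl hp => (hγ p pl).2 ⟨0, hp⟩

theorem Yields.head {S : RTAS} {A B γ : Assembly} (hAB : Attaches S A B) (h : Yields S B γ) :
    Yields S A γ := by
  obtain ⟨f, rfl, hf, hγ⟩ := h
  refine ⟨fun n => Nat.casesOn n A f, rfl, ?_, fun p pl => ?_⟩
  · rintro (_ | n)
    · exact .inr hAB
    · exact hf n
  · rw [hγ]
    constructor
    · rintro ⟨n, hn⟩
      exact ⟨n + 1, hn⟩
    · rintro ⟨_ | n, hn⟩
      · exact ⟨0, hAB.extends _ _ hn⟩
      · exact ⟨n, hn⟩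

theorem Yields.trans {S : RTAS} {A B γ : Assembly} (hAB : ReflTransGen (Attaches S) A B)
    (h : Yields S B γ) : Yields S A γ := by
  induction hAB using ReflTransGen.head_induction_on with
  | refl => exact h
  | head h1 _ ih => exact ih.head h1

theorem Yields.bondConnected {S : RTAS} (hτ : S.temp = 1) {A γ : Assembly}
    (hA : BondConnected A) (h : Yields S A γ) : BondConnected γ := by
  obtain ⟨f, rfl, hf, hγ⟩ := h
  intro p hp q hq
  obtain ⟨a, ha⟩ := mem_adom_iff.1 hp
  obtain ⟨b, hb⟩ := mem_adom_iff.1 hq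
  obtain ⟨m, hm⟩ := (hγ _ _).1 ha
  obtain ⟨n, hn⟩ := (hγ _ _).1 hb
  have hpq := bondConnected_of_steps hτ hA hf (max m n) p
    (mem_adom_iff.2 ⟨a, extends_of_le hf (le_max_left m n) _ _ hm⟩) q
    (mem_adom_iff.2 ⟨b, extends_of_le hf (le_max_right m n) _ _ hn⟩)
  exact hpq.lift id fun _ _ h => h.mono fun p pl hp => (hγ p pl).2 ⟨_, hp⟩

theorem Producible.mem_tiles {S : RTAS} {γ : Assembly} (h : Producible S γ) {p : ℤ × ℤ}
    {pl : Placement} (hp : γ p = some pl) : pl.1 ∈ S.tiles := by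
  obtain ⟨f, h0, hf, hγ⟩ := h
  obtain ⟨n, hn⟩ := (hγ _ _).1 hp
  induction n generalizing p pl with
  | zero => exact S.seed_tiles p pl (h0 ▸ hn)
  | succ n ih =>
    rcases hf n with h1 | ⟨q, t, r, hq, ht, h1, -⟩
    · rw [h1] at hn
      exact ih hp hn
    · rw [h1, Function.update_apply] at hn
      split_ifs at hn with hpq
      · obtain rfl := Option.some.inj hn
        exact ht
      · exact ih hp hn

/-- Every connected assembly grows into one to which nothing can be attached: run through
all positions infinitely often, attaching a tile whenever possible. -/
theorem exists_yields_terminal {S : RTAS} (hτ : S.temp = 1) {A : Assembly}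
    (hA : BondConnected A) (hne : (adom A).Nonempty) :
    ∃ γ, Yields S A γ ∧ ∀ B, ¬ Attaches S γ B := by
  let AttachAt (p : ℤ × ℤ) (A B : Assembly) : Prop := ∃ (t : TileType) (r : Reflection),
    A p = none ∧ t ∈ S.tiles ∧ B = Function.update A p (some (t, r)) ∧ Stable B S.temp
  have hnext : ∀ p A, ∃ B, AttachAt p A B ∨ (B = A ∧ ¬ ∃ B, AttachAt p A B) := by
    intro p A
    rcases em (∃ B, AttachAt p A B) with ⟨B, hB⟩ | h
    · exact ⟨B, .inl hB⟩
    · exact ⟨A, .inr ⟨rfl, h⟩⟩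
  choose next hnext using hnext
  obtain ⟨e, he⟩ := exists_surjective_nat (ℤ × ℤ)
  let f : ℕ → Assembly := fun n => Nat.rec A (fun k B => next (e k.unpair.1) B) n
  have hsucc : ∀ n, f (n + 1) = next (e n.unpair.1) (f n) := fun _ => rfl
  have hf : ∀ n, f (n + 1) = f n ∨ Attaches S (f n) (f (n + 1)) := by
    intro n
    rw [hsucc]
    rcases hnext (e n.unpair.1) (f n) with h | h
    · exact .inr ⟨_, h⟩
    · exact .inl h.1
  have hlim : ∀ p, ∃ o : Option Placement, ∀ pl, o = some pl ↔ ∃ n, f n p = some pl := by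
    intro p
    rcases em (∃ n pl, f n p = some pl) with ⟨m, a, hm⟩ | h
    · refine ⟨some a, fun b => ⟨?_, ?_⟩⟩
      · rintro ⟨⟩
        exact ⟨m, hm⟩
      · rintro ⟨n, hn⟩
        exact (extends_of_le hf (le_max_left m n) _ _ hm).symm.trans
          (extends_of_le hf (le_max_right m n) _ _ hn)
    · exact ⟨none, fun b => ⟨nofun, fun ⟨n, hn⟩ => (h ⟨n, b, hn⟩).elim⟩⟩
  choose γ hγ using hlim
  refine ⟨γ, ⟨f, rfl, hf, hγ⟩, ?_⟩
  rintro _ ⟨p, t, r, hp, ht, rfl, hst⟩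
  have hfp : ∀ n, f n p = none := by
    intro n
    by_contra h
    obtain ⟨pl, hpl⟩ := Option.ne_none_iff_exists'.1 h
    rw [(hγ p pl).2 ⟨n, hpl⟩] at hp
    cases hp
  rw [hτ, stable_one_iff] at hst
  obtain ⟨a, ha⟩ := hne
  obtain ⟨a', ha'⟩ := mem_adom_iff.1 ha
  have hap : a ≠ p := by
    rintro rfl
    exact ha (hfp 0)
  have haγ : γ a = some a' := (hγ _ _).2 ⟨0, ha'⟩
  have hreach := hst p (by simp [adom]) a (by simp [adom, Function.update_of_ne hap, haγ])
  obtain ⟨q, hpq, -⟩ := (ReflTransGen.cases_head hreach).resolve_left hap.symm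
  obtain ⟨x, y, hx, hy, hxy⟩ := bondAdj_iff.1 hpq
  have hqp : q ≠ p := hpq.ne.symm
  rw [Function.update_of_ne hqp] at hy
  obtain ⟨m, hm⟩ := (hγ _ _).1 hy
  obtain ⟨i, hi⟩ := he p
  set n := Nat.pair i m
  have hmn : m ≤ n := Nat.right_le_pair i m
  have hq : f n q = some y := extends_of_le hf hmn _ _ hm
  have hst' : Stable (Function.update (f n) p (some (t, r))) S.temp := by
    rw [hτ, stable_one_iff]
    refine bondConnected_update (bondConnected_of_steps hτ hA hf n) (hfp n)
      (mem_adom_iff.2 ⟨y, hq⟩) (bondAdj_iff.2 ⟨x, y, ?_, ?_, hxy⟩)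
    · simpa using hx
    · rwa [Function.update_of_ne hqp]
  have hex : ∃ B, AttachAt (e n.unpair.1) (f n) B := by
    simp only [n, Nat.unpair_pair, hi]
    exact ⟨_, t, r, hfp n, ht, rfl, hst'⟩
  obtain ⟨t', r', -, -, hB, -⟩ := (hnext (e n.unpair.1) (f n)).resolve_right fun h => h.2 hex
  have hfin := hfp (n + 1)
  rw [hsucc, hB] at hfin
  simp [n, hi] at hfin

/-- A path leaving `y` for good starts with an edge out of `y` and then avoids `y`. -/
theorem exists_last_departure {V : Type*} {R : V → V → Prop} {y x : V}
    (h : ReflTransGen R y x) :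
    x = y ∨ ∃ z, R y z ∧ ReflTransGen (fun a b => R a b ∧ a ≠ y ∧ b ≠ y) z x := by
  induction h with
  | refl => exact .inl rfl
  | @tail b c _ hbc ih =>
    by_cases hc : c = y
    · exact .inl hc
    · refine .inr ?_
      by_cases hb : b = y
      · exact ⟨c, hb ▸ hbc, .refl⟩
      · obtain ⟨z, hz, hzb⟩ := ih.resolve_left hb
        exact ⟨z, hz, hzb.tail ⟨hbc, hb, hc⟩⟩

theorem exists_next_nonbridge {A : Assembly} {x y : ℤ × ℤ} (hxy : BondAdj A x y)
    (h : ReflTransGen (BondAdjAvoiding A x y) y x) :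
    ∃ z, BondAdj A y z ∧ z ≠ x ∧ ReflTransGen (BondAdjAvoiding A y z) z y := by
  obtain ⟨z, hyz, hzx⟩ := (exists_last_departure h).resolve_left hxy.ne
  have hz : z ≠ x := by
    rintro rfl
    exact hyz.2 (.inr ⟨rfl, rfl⟩)
  refine ⟨z, hyz.1, hz, (hzx.lift id ?_).tail ⟨hxy, ?_⟩⟩
  · rintro a b ⟨hab, ha, hb⟩
    exact ⟨hab.1, by rintro (⟨h, -⟩ | ⟨-, h⟩) <;> contradiction⟩
  · rintro (⟨h, -⟩ | ⟨h, -⟩)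
    · exact hxy.ne h
    · exact hz h.symm

theorem exists_nonBacktracking_of_nonbridge {A : Assembly} {x y : ℤ × ℤ} (hxy : BondAdj A x y)
    (h : ReflTransGen (BondAdjAvoiding A x y) y x) :
    ∃ w, NonBacktracking A w ∧ w 0 = x := by
  let Dart := {d : (ℤ × ℤ) × (ℤ × ℤ) //
    BondAdj A d.1 d.2 ∧ ReflTransGen (BondAdjAvoiding A d.1 d.2) d.2 d.1}
  have hnext : ∀ d : Dart, ∃ d' : Dart, d'.1.1 = d.1.2 ∧ d'.1.2 ≠ d.1.1 := by
    rintro ⟨⟨a, b⟩, h1, h2⟩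
    obtain ⟨z, hz1, hz2, hz3⟩ := exists_next_nonbridge h1 h2
    exact ⟨⟨(b, z), hz1, hz3⟩, rfl, hz2⟩
  choose next hn1 hn2 using hnext
  let D : ℕ → Dart := fun n => next^[n] ⟨(x, y), hxy, h⟩
  have hD : ∀ n, D (n + 1) = next (D n) := fun n => Function.iterate_succ_apply' next n _
  have hfst : ∀ n, (D (n + 1)).1.1 = (D n).1.2 := fun n => by rw [hD, hn1]
  refine ⟨fun n => (D n).1.1, fun n => ⟨?_, ?_⟩, rfl⟩
  · simp only [hfst]
    exact (D n).2.1
  · simp only [hfst (n + 1)]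
    rw [hD]
    exact hn2 _

theorem exists_nonBacktracking_of_bondAdj {A : Assembly} {v u : ℤ × ℤ} (hvu : BondAdj A v u)
    (h : ∃ w, NonBacktracking A w ∧ w 0 = v) : ∃ w, NonBacktracking A w ∧ w 0 = u := by
  obtain ⟨w, hw, rfl⟩ := h
  by_cases h1 : w 1 = u
  · exact ⟨fun n => w (n + 1), fun n => hw (n + 1), h1⟩
  · refine ⟨fun n => Nat.casesOn n u w, ?_, rfl⟩
    rintro (_ | n)
    · exact ⟨hvu.symm, h1⟩
    · exact hw n

theorem exists_nonBacktracking_of_reachable {A : Assembly} {v u : ℤ × ℤ}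
    (hvu : ReflTransGen (BondAdj A) v u) (h : ∃ w, NonBacktracking A w ∧ w 0 = v) :
    ∃ w, NonBacktracking A w ∧ w 0 = u := by
  induction hvu with
  | refl => exact h
  | tail _ hab ih => exact exists_nonBacktracking_of_bondAdj hab ih

/-- Reflecting a tile together with the direction in which it faces does not change the glue. -/
theorem facingGlue_comp (t : TileType) (ρ r : Reflection) (P w w' : ℤ × ℤ) :
    facingGlue (t, Reflection.comp ρ r) P (P + Reflection.onPoint ρ (w' - w)) =
      facingGlue (t, r) w w' := by
  obtain ⟨d, rfl⟩ : ∃ d, w' = w + d := ⟨w' - w, by abel⟩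
  obtain ⟨d₁, d₂⟩ := d
  obtain ⟨P₁, P₂⟩ := P
  obtain ⟨w₁, w₂⟩ := w
  obtain ⟨_ | _, _ | _⟩ := ρ <;> obtain ⟨_ | _, _ | _⟩ := r <;>
    simp [facingGlue, Reflection.comp, Reflection.onPoint, TileType.reflect, TileType.north,
      TileType.east, TileType.south, TileType.west, sub_eq_add_neg, neg_eq_iff_eq_neg] <;>
    split_ifs <;> first | rfl | omega

/-- The reflection of the tile between the steps `d` and `d'` that turns both of them into the
quadrant with signs `(a, b)`. -/
def unfoldReflection (a b : ℤ) (d d' : ℤ × ℤ) : Reflection :=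
  (decide (a * d.1 < 0 ∨ a * d'.1 < 0), decide (b * d.2 < 0 ∨ b * d'.2 < 0))

theorem onPoint_unfoldReflection {a b : ℤ} (ha : a = 1 ∨ a = -1) (hb : b = 1 ∨ b = -1)
    {d d' : ℤ × ℤ} (hd : d.1.natAbs + d.2.natAbs ≤ 1) (hd' : d'.1.natAbs + d'.2.natAbs ≤ 1)
    (hdd : d = 0 ∨ d + d' ≠ 0) :
    (Reflection.onPoint (unfoldReflection a b d d') d = (a * |d.1|, b * |d.2|)) ∧
    (Reflection.onPoint (unfoldReflection a b d d') d' = (a * |d'.1|, b * |d'.2|)) := by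
  obtain ⟨x, y⟩ := d
  obtain ⟨x', y'⟩ := d'
  simp only [Prod.mk_add_mk, ne_eq, Prod.mk_eq_zero] at hd hd' hdd
  simp only [Reflection.onPoint, unfoldReflection, decide_eq_true_eq, Prod.mk.injEq]
  rcases ha with rfl | rfl <;> rcases hb with rfl | rfl <;>
    simp only [abs_eq_max_neg] <;> refine ⟨⟨?_, ?_⟩, ?_, ?_⟩ <;> split_ifs <;> omega

/-- A non-backtracking walk from the seed can be unfolded into a monotone path, so arbitrarily
large assemblies can be grown along it. -/
theorem exists_large_of_nonBacktracking {S : RTAS} (hτ : S.temp = 1) {s : ℤ × ℤ}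
    (hs : adom S.seed = {s}) {α : Assembly} (hα : Producible S α) {w : ℕ → ℤ × ℤ}
    (hw : NonBacktracking α w) (hw0 : w 0 = s) (n : ℕ) :
    ∃ (β : Assembly) (F : Finset (ℤ × ℤ)), ReflTransGen (Attaches S) S.seed β ∧
      BondConnected β ∧ F.card = n + 1 ∧ ↑F ⊆ adom β := by
  have hpl : ∀ n, ∃ pl, α (w n) = some pl := fun n => mem_adom_iff.1 (hw n).1.mem_left
  choose T hT using hpl
  let d : ℕ → ℤ × ℤ := fun n => w (n + 1) - w n
  let d₀ : ℕ → ℤ × ℤ := fun n => Nat.casesOn n 0 d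
  have hd : ∀ n, (d n).1.natAbs + (d n).2.natAbs = 1 := fun n => (hw n).1.symm.gridAdj
  have hd₀ : ∀ n, (d₀ n).1.natAbs + (d₀ n).2.natAbs ≤ 1 := by
    rintro (_ | n)
    · simp [d₀]
    · exact (hd n).le
  have hdd : ∀ n, d₀ n = 0 ∨ d₀ n + d n ≠ 0 := by
    rintro (_ | n)
    · exact .inl rfl
    · refine .inr fun h => (hw n).2 ?_
      have h' : (w (n + 1) - w n) + (w (n + 2) - w (n + 1)) = 0 := h
      rw [sub_add_sub_cancel'] at h'
      exact sub_eq_zero.1 h'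
  obtain ⟨a, ha, ha0⟩ : ∃ a : ℤ, (a = 1 ∨ a = -1) ∧ ¬ a * (d 0).1 < 0 := by
    by_cases h : (d 0).1 < 0
    · exact ⟨-1, .inr rfl, by omega⟩
    · exact ⟨1, .inl rfl, by omega⟩
  obtain ⟨b, hb, hb0⟩ : ∃ b : ℤ, (b = 1 ∨ b = -1) ∧ ¬ b * (d 0).2 < 0 := by
    by_cases h : (d 0).2 < 0
    · exact ⟨-1, .inr rfl, by omega⟩
    · exact ⟨1, .inl rfl, by omega⟩
  let ρ : ℕ → Reflection := fun n => unfoldReflection a b (d₀ n) (d n)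
  have hρ : ∀ n, Reflection.onPoint (ρ n) (d n) = (a * |(d n).1|, b * |(d n).2|) := fun n =>
    (onPoint_unfoldReflection ha hb (hd₀ n) (hd n).le (hdd n)).2
  have hρ' : ∀ n, Reflection.onPoint (ρ (n + 1)) (d n) = (a * |(d n).1|, b * |(d n).2|) :=
    fun n => (onPoint_unfoldReflection ha hb (hd₀ (n + 1)) (hd (n + 1)).le (hdd (n + 1))).1
  have hlevel : ∀ n, a * (a * |(d n).1|) + b * (b * |(d n).2|) = 1 := by
    intro n
    have := hd n
    rcases ha with rfl | rfl <;> rcases hb with rfl | rfl <;> simp [abs_eq_max_neg] <;> omega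
  suffices ∃ (β : Assembly) (F : Finset (ℤ × ℤ)) (P : ℤ × ℤ),
      ReflTransGen (Attaches S) S.seed β ∧ BondConnected β ∧ F.card = n + 1 ∧ ↑F ⊆ adom β ∧
      β P = some ((T n).1, Reflection.comp (ρ n) (T n).2) ∧
      ∀ p ∈ adom β, a * p.1 + b * p.2 ≤ a * P.1 + b * P.2 by
    obtain ⟨β, F, P, h1, h2, h3, h4, -⟩ := this
    exact ⟨β, F, h1, h2, h3, h4⟩
  induction n with
  | zero =>
    refine ⟨S.seed, {s}, s, .refl, ?_, by simp, by simp [hs], ?_, by simp [hs]⟩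
    · have := S.seed_stable
      rwa [hτ, stable_one_iff] at this
    · have hρ0 : ρ 0 = (false, false) := by
        simp [ρ, unfoldReflection, d₀] at ha0 hb0 ⊢
        exact ⟨ha0, hb0⟩
      obtain ⟨pl, hpl⟩ := mem_adom_iff.1 (by simp [hs] : s ∈ adom S.seed)
      have h0 := hT 0
      rw [hw0, Yields.extends hα s pl hpl] at h0
      rw [hpl, h0, hρ0]
      simp [Reflection.comp]
  | succ n ih =>
    obtain ⟨β, F, P, hβ, hcon, hF, hFβ, hP, hmax⟩ := ih
    set v : ℤ × ℤ := (a * |(d n).1|, b * |(d n).2|) with hv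
    have hlev : a * (P + v).1 + b * (P + v).2 = a * P.1 + b * P.2 + 1 := by
      rw [← hlevel n]
      simp only [hv, Prod.fst_add, Prod.snd_add]
      ring
    have hnot : P + v ∉ adom β := fun h => by
      have := hmax _ h
      omega
    have hnone : β (P + v) = none := not_not.1 hnot
    have hPne : P ≠ P + v := by
      rintro h
      rw [← h] at hnone
      simp [hP] at hnone
    set pl : Placement := ((T (n + 1)).1, Reflection.comp (ρ (n + 1)) (T (n + 1)).2) with hpl
    have hbond : BondAdj (Function.update β (P + v) (some pl)) (P + v) P := by
      refine BondAdj.symm (bondAdj_iff.2 ⟨_, pl, by rwa [Function.update_of_ne hPne],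
        Function.update_self .., ?_⟩)
      obtain ⟨x, y, hx, hy, hxy⟩ := bondAdj_iff.1 (hw n).1
      obtain rfl := Option.some.inj ((hT n).symm.trans hx)
      obtain rfl := Option.some.inj ((hT (n + 1)).symm.trans hy)
      have e1 := facingGlue_comp (T n).1 (ρ n) (T n).2 P (w n) (w (n + 1))
      rw [show Reflection.onPoint (ρ n) (w (n + 1) - w n) = v from hρ n] at e1
      have e2 := facingGlue_comp (T (n + 1)).1 (ρ (n + 1)) (T (n + 1)).2 (P + v)
        (w (n + 1)) (w n)
      have hneg : Reflection.onPoint (ρ (n + 1)) (w n - w (n + 1)) = -v := by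
        rw [hv, ← hρ' n]
        simp only [Reflection.onPoint, d]
        ext <;> simp <;> split_ifs <;> ring
      rw [hneg, add_neg_cancel_right] at e2
      rw [e1, hpl, e2]
      exact hxy
    have hcon' := bondConnected_update hcon hnone (mem_adom_iff.2 ⟨_, hP⟩) hbond
    refine ⟨Function.update β (P + v) (some pl), insert (P + v) F, P + v,
      hβ.tail ⟨P + v, _, _, hnone, hα.mem_tiles (hT (n + 1)), rfl, ?_⟩, hcon', ?_, ?_,
      Function.update_self .., ?_⟩
    · rw [hτ]
      exact stable_one_iff.2 hcon'
    · rw [Finset.card_insert_of_notMem fun h => hnot (hFβ h), hF]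
    · intro p hp
      rcases Finset.mem_insert.1 hp with rfl | hp
      · simp [adom]
      · obtain ⟨x, hx⟩ := mem_adom_iff.1 (hFβ hp)
        exact mem_adom_iff.2 ⟨x, extends_update hnone _ _ _ hx⟩
    · intro p hp
      by_cases hpP : p = P + v
      · rw [hpP]
      · have := hmax p (by simpa [adom, Function.update_of_ne hpP] using hp)
        omega

theorem card_le_of_adom_transform_eq {γ : Assembly} {r : Reflection} {v : ℤ × ℤ}
    {X : Set (ℤ × ℤ)} (hX : X.Finite) (h : adom (transform γ r v) = X)
    {F : Finset (ℤ × ℤ)} (hF : ↑F ⊆ adom γ) : F.card ≤ X.ncard := by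
  have hinv : ∀ p, Reflection.onPoint r (Reflection.onPoint r p) = p := by
    intro p
    simp only [Reflection.onPoint]
    ext <;> simp <;> split_ifs <;> simp
  rw [← Set.ncard_coe_finset]
  refine Set.ncard_le_ncard_of_injOn (fun p => Reflection.onPoint r p + v) ?_ ?_ hX
  · intro p hp
    rw [← h]
    simpa [adom, transform, hinv] using hF hp
  · intro p _ q _ hpq
    rw [← hinv p, ← hinv q, add_right_cancel hpq]

/-- In a singly seeded mismatch-free temperature-1 RTAM system strictly
self-assembling a finite connected shape, the binding graph of any terminal assembly is a
tree. -/
theorem rtam_mismatch_free_terminal_binding_graph_is_tree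
    (S : Set (ℤ × ℤ)) (hS : IsShape S)
    (Sys : RTAS) (hτ : Sys.temp = 1) (hss : SinglySeeded Sys) (hmf : MismatchFree Sys)
    (hsa : StrictlySelfAssembles Sys S)
    (α : Assembly) (hα : Terminal Sys α) :
    BindingGraphIsTree α := by
  obtain ⟨s, hs⟩ := hss
  have hseed : BondConnected Sys.seed := by
    have := Sys.seed_stable
    rwa [hτ, stable_one_iff] at this
  have hcon : BondConnected α := Yields.bondConnected hτ hseed hα.1
  refine ⟨hcon, fun p q hpq hreach => ?_⟩
  have hreach' : ReflTransGen (BondAdjAvoiding α q p) p q :=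
    hreach.lift id fun a b h => ⟨h.1, fun h' => h.2 h'.symm⟩
  obtain ⟨x, hx⟩ := mem_adom_iff.1 (by simp [hs] : s ∈ adom Sys.seed)
  have hsα : s ∈ adom α := mem_adom_iff.2 ⟨x, Yields.extends hα.1 _ _ hx⟩
  obtain ⟨w, hw, hw0⟩ := exists_nonBacktracking_of_reachable (hcon q hpq.mem_right s hsα)
    (exists_nonBacktracking_of_nonbridge hpq.symm hreach')
  obtain ⟨β, F, hβ, hβcon, hF, hFβ⟩ :=
    exists_large_of_nonBacktracking hτ hs hα.1 hw hw0 S.ncard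
  obtain ⟨y, hy⟩ := Finset.card_pos.1 (by omega : 0 < F.card)
  obtain ⟨γ, hγ, hterm⟩ := exists_yields_terminal hτ hβcon ⟨y, hFβ hy⟩
  obtain ⟨r, v, hrv⟩ := hsa γ ⟨hγ.trans hβ, hterm⟩
  have hFγ : ↑F ⊆ adom γ := fun p hp => by
    obtain ⟨z, hz⟩ := mem_adom_iff.1 (hFβ hp)
    exact mem_adom_iff.2 ⟨z, hγ.extends _ _ hz⟩
  have := card_le_of_adom_transform_eq hS.1 hrv hFγ
  omega
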